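/- Let n ≥ 5 and let u ∈ ℝ^{n−2} be a vector with positive entries which is palindromic, i.e., u_i = u_{n−1−i} for all i = 1,…,n−2. For j = 1,…,n define u^j ∈ ℝⁿ by u^j_{I_j} = u (the entry of u^j at position j+i−1 mod n equals u_i) and u^j_i = 0 for i ∉ I_j. Suppose there exists an exceptional copositive n×n matrix A with (u^j)ᵀAu^j = 0 for all j = 1,…,n. Then there exists an exceptional copositive circulant n×n matrix A′ with (u^j)ᵀA′u^j = 0 for all j = 1,…,n. -/

import Mathlib

open Matrix

/-- A real symmetric matrix is copositive if its quadratic form is nonnegative on the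
nonnegative orthant. -/
def Copositive {n : ℕ} (A : Matrix (Fin n) (Fin n) ℝ) : Prop :=
  ∀ x : Fin n → ℝ, (∀ i, 0 ≤ x i) → 0 ≤ x ⬝ᵥ A.mulVec x

/-- A copositive matrix is exceptional if it is not the sum of a positive semidefinite matrix
and a symmetric entrywise nonnegative matrix. -/
def Exceptional {n : ℕ} (A : Matrix (Fin n) (Fin n) ℝ) : Prop :=
  ¬ ∃ P N : Matrix (Fin n) (Fin n) ℝ,
      P.PosSemidef ∧ N.IsSymm ∧ (∀ i j, 0 ≤ N i j) ∧ A = P + N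

/-- A copositive matrix is extremal if in any decomposition into a sum of two copositive
matrices both summands are nonnegative multiples of it. -/
def ExtremalCopositive {n : ℕ} (A : Matrix (Fin n) (Fin n) ℝ) : Prop :=
  Copositive A ∧ ∀ A₁ A₂ : Matrix (Fin n) (Fin n) ℝ, Copositive A₁ → Copositive A₂ →
    A = A₁ + A₂ → ∃ c₁ c₂ : ℝ, 0 ≤ c₁ ∧ 0 ≤ c₂ ∧ A₁ = c₁ • A ∧ A₂ = c₂ • A

/-- A zero of a copositive matrix: a nonzero nonnegative vector on which the quadratic
form vanishes. -/
def IsZeroOf {n : ℕ} (A : Matrix (Fin n) (Fin n) ℝ) (u : Fin n → ℝ) : Prop :=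
  u ≠ 0 ∧ (∀ i, 0 ≤ u i) ∧ u ⬝ᵥ A.mulVec u = 0

/-- The support of a vector: the set of indices of its positive entries. -/
def supp {n : ℕ} (u : Fin n → ℝ) : Set (Fin n) := {i | 0 < u i}

/-- The embedding of `Fin (n-2)` into `Fin n` enumerating the cyclic index set
`I_j = {j, j+1, ..., j+(n-3)}` (0-based). -/
def circEmb (n : ℕ) (j : Fin n) : Fin (n - 2) → Fin n :=
  fun s => j + Fin.castLE (Nat.sub_le n 2) s

/-- The cyclic index set `I_j` of cardinality `n-2`. -/
def circIdx (n : ℕ) (j : Fin n) : Set (Fin n) := Set.range (circEmb n j)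

/-- The principal submatrix `A_{I_j}`. -/
def circSub {n : ℕ} (A : Matrix (Fin n) (Fin n) ℝ) (j : Fin n) :
    Matrix (Fin (n - 2)) (Fin (n - 2)) ℝ :=
  A.submatrix (circEmb n j) (circEmb n j)

/-- A minimal zero of a copositive matrix: a zero whose support does not strictly
contain the support of another zero. -/
def MinimalZero {n : ℕ} (A : Matrix (Fin n) (Fin n) ℝ) (u : Fin n → ℝ) : Prop :=
  IsZeroOf A u ∧ ∀ v, IsZeroOf A v → ¬ (supp v ⊂ supp u)

theorem mem_circIdx_iff {n : ℕ} [NeZero n] (i j : Fin n) :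
    i ∈ circIdx n j ↔ (i - j).val < n - 2 := by
  constructor
  · rintro ⟨s, rfl⟩
    simp [circEmb]
  · intro h
    exact ⟨⟨(i - j).val, h⟩, by simp [circEmb]⟩

/-- Any two indices lie in a common index set `I_k`. -/
theorem exists_mem_circIdx_pair {n : ℕ} [NeZero n] (hn : 5 ≤ n) (i j : Fin n) :
    ∃ k, i ∈ circIdx n k ∧ j ∈ circIdx n k := by
  simp only [mem_circIdx_iff]
  have hi := i.isLt
  have hj := j.isLt
  by_cases h : (j - i).val < n - 2
  · exact ⟨i, by simp; omega, h⟩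
  · refine ⟨j, ?_, by simp; omega⟩
    rcases lt_trichotomy i j with hij | rfl | hij
    · rw [Fin.sub_val_of_le hij.le] at h
      rw [Fin.coe_sub_iff_lt.2 hij]
      omega
    · simp; omega
    · rw [Fin.sub_val_of_le hij.le]
      rw [Fin.coe_sub_iff_lt.2 hij] at h
      omega

theorem quadForm_add_smul {n : ℕ} {A : Matrix (Fin n) (Fin n) ℝ} (hA : A.IsSymm)
    (x y : Fin n → ℝ) (t : ℝ) :
    (x + t • y) ⬝ᵥ A.mulVec (x + t • y) =
      x ⬝ᵥ A.mulVec x + 2 * t * (y ⬝ᵥ A.mulVec x) + t ^ 2 * (y ⬝ᵥ A.mulVec y) := by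
  have h : x ⬝ᵥ A.mulVec y = y ⬝ᵥ A.mulVec x := by
    rw [dotProduct_mulVec, ← mulVec_transpose, hA.eq, dotProduct_comm]
  simp only [mulVec_add, mulVec_smul, add_dotProduct, dotProduct_add, smul_dotProduct,
    dotProduct_smul, smul_eq_mul, h]
  ring

theorem nonneg_of_quadratic_nonneg {b c : ℝ} (h : ∀ t : ℝ, 0 < t → 0 ≤ 2 * t * b + t ^ 2 * c) :
    0 ≤ b := by
  by_contra! hb
  have hc : 0 < |c| + 1 := by positivity
  have h1 := h (-b / (|c| + 1)) (div_pos (by linarith) hc)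
  set t := -b / (|c| + 1) with ht
  have ht0 : 0 < t := div_pos (by linarith) hc
  have htb : t * (|c| + 1) = -b := by rw [ht]; field_simp
  have h2 : 0 ≤ 2 * b + t * c := by
    by_contra! h3
    nlinarith
  nlinarith [le_abs_self c]

/-- A copositive matrix maps each of its zeros to a nonnegative vector. -/
theorem Copositive.mulVec_nonneg {n : ℕ} {A : Matrix (Fin n) (Fin n) ℝ} (hA : Copositive A)
    (hs : A.IsSymm) {u : Fin n → ℝ} (hu : ∀ i, 0 ≤ u i) (h0 : u ⬝ᵥ A.mulVec u = 0)
    (i : Fin n) : 0 ≤ A.mulVec u i := by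
  refine nonneg_of_quadratic_nonneg
    (c := Pi.single i (1 : ℝ) ⬝ᵥ A.mulVec (Pi.single i (1 : ℝ))) fun t ht => ?_
  have h := hA (u + t • Pi.single i (1 : ℝ)) fun l => by
    have : (0 : ℝ) ≤ Pi.single (M := fun _ => ℝ) i 1 l := by
      rw [Pi.single_apply]; split_ifs <;> norm_num
    simp only [Pi.add_apply, Pi.smul_apply, smul_eq_mul]
    have := hu l
    positivity
  rw [quadForm_add_smul hs, h0] at h
  simpa using h

/-- If `u` lies in the kernel of a copositive matrix, then the quadratic form is nonnegative on
vectors supported where `u` is positive. -/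
theorem Copositive.quadForm_nonneg_of_support {n : ℕ} {A : Matrix (Fin n) (Fin n) ℝ}
    (hA : Copositive A) (hs : A.IsSymm) {u : Fin n → ℝ} (hu : ∀ i, 0 ≤ u i)
    (h0 : A.mulVec u = 0) {y : Fin n → ℝ} (hy : ∀ i, u i = 0 → y i = 0) :
    0 ≤ y ⬝ᵥ A.mulVec y := by
  obtain ⟨T, hT⟩ : ∃ T : ℝ, ∀ i, u i ≠ 0 → |y i| / u i ≤ T :=
    ⟨∑ i, |y i| / u i, fun i _ => Finset.single_le_sum
      (f := fun i => |y i| / u i) (fun l _ => div_nonneg (abs_nonneg _) (hu l))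
      (Finset.mem_univ i)⟩
  have h := hA (y + T • u) fun i => by
    simp only [Pi.add_apply, Pi.smul_apply, smul_eq_mul]
    rcases eq_or_ne (u i) 0 with h | h
    · simp [h, hy i h]
    · have h1 := (div_le_iff₀ (lt_of_le_of_ne (hu i) h.symm)).1 (hT i h)
      linarith [neg_abs_le (y i)]
  have h1 : u ⬝ᵥ A.mulVec y = 0 := by
    rw [dotProduct_mulVec, ← mulVec_transpose, hs.eq, h0, zero_dotProduct]
  rw [quadForm_add_smul hs, h1, h0, dotProduct_zero] at h
  simpa using h

/-- The sum of all simultaneous cyclic shifts of rows and columns. -/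
def cyclicSum {n : ℕ} (A : Matrix (Fin n) (Fin n) ℝ) : Matrix (Fin n) (Fin n) ℝ :=
  ∑ k : Fin n, A.submatrix (· + k) (· + k)

theorem cyclicSum_apply {n : ℕ} (A : Matrix (Fin n) (Fin n) ℝ) (i j : Fin n) :
    cyclicSum A i j = ∑ k, A (i + k) (j + k) := by
  simp [cyclicSum, Matrix.sum_apply]

theorem cyclicSum_add_add {n : ℕ} [NeZero n] (A : Matrix (Fin n) (Fin n) ℝ) (i j k : Fin n) :
    cyclicSum A (i + k) (j + k) = cyclicSum A i j := by
  simp only [cyclicSum_apply, add_assoc]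
  exact Equiv.sum_comp (Equiv.addLeft k) fun l => A (i + l) (j + l)

theorem cyclicSum_isSymm {n : ℕ} {A : Matrix (Fin n) (Fin n) ℝ} (hA : A.IsSymm) :
    (cyclicSum A).IsSymm :=
  IsSymm.ext fun i j => by simp only [cyclicSum_apply, hA.apply]

theorem cyclicSum_mulVec {n : ℕ} [NeZero n] (A : Matrix (Fin n) (Fin n) ℝ) (x : Fin n → ℝ)
    (i : Fin n) :
    (cyclicSum A).mulVec x i = ∑ k, A.mulVec (fun l => x (l - k)) (i + k) := by
  rw [cyclicSum, sum_mulVec, Finset.sum_apply]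
  refine Finset.sum_congr rfl fun k _ => ?_
  rw [← Equiv.coe_addRight, submatrix_mulVec_equiv]
  simp [Function.comp_def, sub_eq_add_neg]

theorem quadForm_cyclicSum {n : ℕ} [NeZero n] (A : Matrix (Fin n) (Fin n) ℝ) (x : Fin n → ℝ) :
    x ⬝ᵥ (cyclicSum A).mulVec x =
      ∑ k, (fun l => x (l - k)) ⬝ᵥ A.mulVec (fun l => x (l - k)) := by
  simp only [dotProduct, cyclicSum_mulVec, Finset.mul_sum]
  rw [Finset.sum_comm]
  refine Finset.sum_congr rfl fun k _ => ?_
  rw [← Equiv.sum_comp (Equiv.addRight k) fun i => x (i - k) * _]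
  simp

/-- A symmetric nonnegative matrix whose quadratic form vanishes on nonnegative vectors `w k` such
that any two indices lie in the support of some `w k` is zero. -/
theorem eq_zero_of_nonneg_of_quadForm_eq_zero {n : ℕ} {N : Matrix (Fin n) (Fin n) ℝ}
    (hN : ∀ i j, 0 ≤ N i j) {ι : Type*} {w : ι → Fin n → ℝ} (hw : ∀ k i, 0 ≤ w k i)
    (hpair : ∀ i j, ∃ k, 0 < w k i ∧ 0 < w k j) (h0 : ∀ k, w k ⬝ᵥ N.mulVec (w k) = 0) :
    N = 0 := by
  ext i j
  obtain ⟨k, hi, hj⟩ := hpair i j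
  have h := h0 k
  have hNw : ∀ l m, 0 ≤ N l m * w k m := fun l m => mul_nonneg (hN l m) (hw k m)
  simp only [dotProduct, mulVec] at h
  rw [Finset.sum_eq_zero_iff_of_nonneg fun l _ =>
    mul_nonneg (hw k l) (Finset.sum_nonneg fun m _ => hNw l m)] at h
  have h1 := (mul_eq_zero.1 (h i (Finset.mem_univ i))).resolve_left hi.ne'
  rw [Finset.sum_eq_zero_iff_of_nonneg fun m _ => hNw i m] at h1
  exact (mul_eq_zero.1 (h1 j (Finset.mem_univ j))).resolve_right hj.ne'

theorem Copositive.cyclicSum {n : ℕ} [NeZero n] {A : Matrix (Fin n) (Fin n) ℝ}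
    (hA : Copositive A) : Copositive (cyclicSum A) := fun x hx => by
  rw [quadForm_cyclicSum]
  exact Finset.sum_nonneg fun k _ => hA _ fun l => hx _

/-- A copositive matrix annihilating a shift-equivariant family of nonnegative vectors with
supports `I_j` is positive semidefinite. -/
theorem Copositive.posSemidef_of_mulVec_eq_zero {n : ℕ} [NeZero n] (hn : 5 ≤ n)
    {A : Matrix (Fin n) (Fin n) ℝ} (hA : Copositive A) (hs : A.IsSymm)
    {w : Fin n → Fin n → ℝ} (hw : ∀ j i, 0 ≤ w j i)
    (hsupp : ∀ j i, w j i = 0 ↔ i ∉ circIdx n j) (h0 : ∀ j, A.mulVec (w j) = 0) :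
    A.PosSemidef := by
  refine PosSemidef.of_dotProduct_mulVec_nonneg ?_ fun x => ?_
  · rw [IsHermitian, conjTranspose_eq_transpose_of_trivial, hs.eq]
  rw [star_trivial]
  let a : Fin n := ⟨n - 2, by omega⟩
  let b : Fin n := ⟨n - 1, by omega⟩
  let c : Fin n := ⟨1, by omega⟩
  let d : Fin n := ⟨2, by omega⟩
  have hval : ∀ {p q : Fin n}, q ≤ p → (p - q).val = p.val - q.val := fun h =>
    Fin.sub_val_of_le h
  have hca : w c a ≠ 0 := by
    rw [Ne, hsupp, not_not, mem_circIdx_iff, hval (by simp [a, c, Fin.le_def]; omega)]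
    simp only [a, c]; omega
  have hcb : w c b = 0 := by
    rw [hsupp, mem_circIdx_iff, hval (by simp [b, c, Fin.le_def]; omega)]
    simp only [b, c]; omega
  have hdb : w d b ≠ 0 := by
    rw [Ne, hsupp, not_not, mem_circIdx_iff, hval (by simp [b, d, Fin.le_def]; omega)]
    simp only [b, d]; omega
  obtain ⟨s, hs1⟩ : ∃ s, x b + s * w d b = 0 := ⟨-(x b / w d b), by field_simp; ring⟩
  obtain ⟨t, ht⟩ : ∃ t, x a + s * w d a + t * w c a = 0 :=
    ⟨-((x a + s * w d a) / w c a), by field_simp; ring⟩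
  have key : ∀ (y : Fin n → ℝ) (r : ℝ) (j : Fin n),
      (y + r • w j) ⬝ᵥ A.mulVec (y + r • w j) = y ⬝ᵥ A.mulVec y := fun y r j => by
    have h1 : w j ⬝ᵥ A.mulVec y = 0 := by
      rw [dotProduct_mulVec, ← mulVec_transpose, hs.eq, h0, zero_dotProduct]
    rw [quadForm_add_smul hs, h1, h0, dotProduct_zero]
    ring
  rw [← key x s d, ← key _ t c]
  refine hA.quadForm_nonneg_of_support hs (hw 0) (h0 0) fun i hi => ?_
  rw [hsupp, mem_circIdx_iff, sub_zero] at hi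
  have hi2 := i.isLt
  rcases (by omega : i.val = n - 2 ∨ i.val = n - 1) with h | h
  · obtain rfl : i = a := Fin.ext h
    simpa using ht
  · obtain rfl : i = b := Fin.ext h
    simpa [hcb] using hs1

/-- The sum of the cyclic shifts of an exceptional copositive matrix is exceptional if the matrix
has a shift-equivariant family of zeros with supports `I_j`. -/
theorem Exceptional.cyclicSum {n : ℕ} [NeZero n] (hn : 5 ≤ n)
    {A : Matrix (Fin n) (Fin n) ℝ} (hE : Exceptional A) (hA : Copositive A) (hs : A.IsSymm)
    {w : Fin n → Fin n → ℝ} (hw : ∀ j i, 0 ≤ w j i)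
    (hsupp : ∀ j i, w j i = 0 ↔ i ∉ circIdx n j)
    (hshift : ∀ j k, (fun l => w j (l - k)) = w (j + k))
    (h0 : ∀ j, w j ⬝ᵥ A.mulVec (w j) = 0) : Exceptional (cyclicSum A) := by
  rintro ⟨P, N, hP, -, hN, hPN⟩
  have hsum : ∀ j, w j ⬝ᵥ P.mulVec (w j) + w j ⬝ᵥ N.mulVec (w j) = 0 := fun j => by
    rw [← dotProduct_add, ← add_mulVec, ← hPN, quadForm_cyclicSum]
    simp [hshift, h0]
  have hP0 : ∀ j, 0 ≤ w j ⬝ᵥ P.mulVec (w j) := fun j => by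
    simpa using hP.dotProduct_mulVec_nonneg (w j)
  have hN0 : ∀ j, 0 ≤ w j ⬝ᵥ N.mulVec (w j) := fun j =>
    dotProduct_nonneg_of_nonneg (hw j) fun i => dotProduct_nonneg_of_nonneg (hN i) (hw j)
  have hpos : ∀ j i, i ∈ circIdx n j → 0 < w j i := fun j i hi =>
    lt_of_le_of_ne (hw j i) fun h => (hsupp j i).1 h.symm hi
  have hNz : N = 0 := eq_zero_of_nonneg_of_quadForm_eq_zero hN hw
    (fun i j => (exists_mem_circIdx_pair hn i j).imp fun k hk =>
      ⟨hpos k i hk.1, hpos k j hk.2⟩)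
    fun k => le_antisymm (by linarith [hsum k, hP0 k]) (hN0 k)
  rw [hNz, add_zero] at hPN
  have hker : ∀ j, (_root_.cyclicSum A).mulVec (w j) = 0 := fun j => by
    rw [hPN]
    refine (hP.dotProduct_mulVec_zero_iff (w j)).1 ?_
    rw [star_trivial]
    exact le_antisymm (by linarith [hsum j, hN0 j]) (hP0 j)
  have hAker : ∀ j, A.mulVec (w j) = 0 := fun j => by
    ext i
    have h := congrFun (hker j) i
    rw [cyclicSum_mulVec] at h
    simp only [hshift, Pi.zero_apply] at h
    rw [Finset.sum_eq_zero_iff_of_nonneg fun k _ =>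
      hA.mulVec_nonneg hs (hw _) (h0 _) _] at h
    simpa using h 0 (Finset.mem_univ 0)
  exact hE ⟨A, 0, hA.posSemidef_of_mulVec_eq_zero hn hs hw hsupp hAker, isSymm_zero,
    fun _ _ => le_rfl, (add_zero A).symm⟩

theorem statement11 (n : ℕ) (hn : 5 ≤ n) (u : Fin (n - 2) → ℝ)
    (hpos : ∀ i, 0 < u i) (hpal : ∀ i, u i = u (Fin.rev i))
    (uu : Fin n → Fin n → ℝ)
    (huu1 : ∀ (j : Fin n) (s : Fin (n - 2)), uu j (circEmb n j s) = u s)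
    (huu2 : ∀ (j : Fin n) (i : Fin n), i ∉ circIdx n j → uu j i = 0)
    (hex : ∃ A : Matrix (Fin n) (Fin n) ℝ, A.IsSymm ∧ Copositive A ∧ Exceptional A ∧
      ∀ j, uu j ⬝ᵥ A.mulVec (uu j) = 0) :
    ∃ A' : Matrix (Fin n) (Fin n) ℝ, A'.IsSymm ∧ Copositive A' ∧ Exceptional A' ∧
      (∀ j, uu j ⬝ᵥ A'.mulVec (uu j) = 0) ∧
      ∀ i j k : Fin n, A' (i + k) (j + k) = A' i j := by
  have : NeZero n := ⟨by omega⟩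
  obtain ⟨A, hs, hA, hE, h0⟩ := hex
  have hmem : ∀ j i, i ∈ circIdx n j → 0 < uu j i := by
    rintro j _ ⟨s, rfl⟩
    rw [huu1]
    exact hpos s
  have hw : ∀ j i, 0 ≤ uu j i := fun j i => by
    by_cases h : i ∈ circIdx n j
    · exact (hmem j i h).le
    · rw [huu2 j i h]
  have hsupp : ∀ j i, uu j i = 0 ↔ i ∉ circIdx n j := fun j i =>
    ⟨fun h hi => (hmem j i hi).ne' h, huu2 j i⟩
  have hshift : ∀ j k, (fun l => uu j (l - k)) = uu (j + k) := fun j k => by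
    ext l
    by_cases h : l ∈ circIdx n (j + k)
    · obtain ⟨s, rfl⟩ := h
      have h1 : circEmb n (j + k) s - k = circEmb n j s := by
        simp only [circEmb]
        abel
      rw [h1, huu1, huu1]
    · rw [huu2 _ _ h, huu2]
      rw [mem_circIdx_iff] at h ⊢
      rwa [sub_sub, add_comm k j]
  refine ⟨cyclicSum A, cyclicSum_isSymm hs, hA.cyclicSum,
    hE.cyclicSum hn hA hs hw hsupp hshift h0, fun j => ?_, cyclicSum_add_add A⟩
  rw [quadForm_cyclicSum]
  simp [hshift, h0]
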